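/- arXiv:2202.09688 — 4 statements merged into one kernel-verified Lean document; each statement's English description precedes it below -/
import Mathlib

section
/- Let μ_x, μ_y > 0 and L_xx, L_yx, L_yy ≥ 0, and let θ ∈ [θ̂, 1) where θ̂ = max{θ̂₁, θ̂₂}. Set τ = (1−θ)/(μ_x θ), σ = (1−θ)/(μ_y θ) and α = θ μ_y/2 (so that α = (1−θ)/(2σ) ∈ (0, 1/σ)). Then min{τ μ_x, σ μ_y} ≥ (1−θ)/θ, and the real symmetric 3×3 matrix [[1/τ − L_xx, 0, −L_yx], [0, 1/σ − α, −L_yy], [−L_yx, −L_yy, α/θ]] is positive semidefinite. -/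
open Matrix Set

/-- θ̂₁ := (L_xx + 4L_yx²/μ_y)/(μ_x + L_xx + 4L_yx²/μ_y). -/
noncomputable def hatTheta1 (μx μy Lxx Lyx : ℝ) : ℝ :=
  (Lxx + 4 * Lyx ^ 2 / μy) / (μx + Lxx + 4 * Lyx ^ 2 / μy)

/-- An arrow-shaped symmetric `3 × 3` matrix is positive semidefinite as soon as each of its first
two diagonal entries dominates its share of the Schur complement of the last one. -/
theorem posSemidef_arrow {a b c p q : ℝ} (hc : 0 < c) (ha : 4 * p ^ 2 / c ≤ a)
    (hb : 4 * q ^ 2 / c ≤ b) :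
    Matrix.PosSemidef (!![a, 0, -p; 0, b, -q; -p, -q, c / 2]) := by
  refine Matrix.PosSemidef.of_dotProduct_mulVec_nonneg ?_ fun v => ?_
  · ext i j
    fin_cases i <;> fin_cases j <;> simp
  · have key (m r x z : ℝ) (hm : 4 * r ^ 2 / c ≤ m) :
        0 ≤ m * x ^ 2 - 2 * r * x * z + c / 4 * z ^ 2 := by
      have h1 : 4 * r ^ 2 / c * x ^ 2 ≤ m * x ^ 2 := by gcongr
      have h2 : 0 ≤ (2 * r * x - c * z / 2) ^ 2 / c := by positivity
      have h3 : (2 * r * x - c * z / 2) ^ 2 / c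
          = 4 * r ^ 2 / c * x ^ 2 - 2 * r * x * z + c / 4 * z ^ 2 := by
        field_simp
        ring
      linarith
    have h1 := key a p (v 0) (v 2) ha
    have h2 := key b q (v 1) (v 2) hb
    simp [dotProduct, Matrix.mulVec, Fin.sum_univ_three]
    linarith

/-- for θ ∈ [θ̂, 1) with θ̂ = max{θ̂₁, θ̂₂} (θ̂₂ being the unique
nonnegative root of θ² + θ(1 + 8L_yy²/μ_y²) − 8L_yy²/μ_y² = 0), the SAPD parameters
τ = (1−θ)/(μ_x θ), σ = (1−θ)/(μ_y θ), α = θμ_y/2 satisfy the step-size condition and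
the 3×3 matrix inequality. -/
theorem sapd_parameters_admissible
    (μx μy Lxx Lyx Lyy : ℝ) (hμx : 0 < μx) (hμy : 0 < μy)
    (hLxx : 0 ≤ Lxx) (hLyx : 0 ≤ Lyx) (hLyy : 0 ≤ Lyy)
    (θ2 : ℝ) (hθ2nonneg : 0 ≤ θ2)
    (hθ2root : θ2 ^ 2 + θ2 * (1 + 8 * Lyy ^ 2 / μy ^ 2) - 8 * Lyy ^ 2 / μy ^ 2 = 0)
    (θ : ℝ) (hθ : θ ∈ Set.Ico (max (hatTheta1 μx μy Lxx Lyx) θ2) 1)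
    (τ σ α : ℝ) (hτ : τ = (1 - θ) / (μx * θ)) (hσ : σ = (1 - θ) / (μy * θ))
    (hα : α = θ * μy / 2) :
    min (τ * μx) (σ * μy) ≥ (1 - θ) / θ ∧
      Matrix.PosSemidef
        (!![1 / τ - Lxx, 0, -Lyx;
            0, 1 / σ - α, -Lyy;
            -Lyx, -Lyy, α / θ]) := by
  obtain ⟨hmax, hlt⟩ := hθ
  obtain ⟨hθ1, hθ2⟩ := max_le_iff.mp hmax
  have h1θ : 0 < 1 - θ := sub_pos.mpr hlt
  have hD : 0 < μx + Lxx + 4 * Lyx ^ 2 / μy := by positivity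
  rw [hatTheta1, div_le_iff₀ hD] at hθ1
  have hx : (Lxx + 4 * Lyx ^ 2 / μy) * (1 - θ) ≤ μx * θ := by linarith
  have hy : 8 * Lyy ^ 2 / μy ^ 2 * (1 - θ) ≤ θ * (1 + θ) := by
    have hK : 0 ≤ 8 * Lyy ^ 2 / μy ^ 2 := by positivity
    nlinarith
  rcases (hθ2nonneg.trans hθ2).eq_or_lt with rfl | hpos
  · have hp : 0 ≤ 4 * Lyx ^ 2 / μy := by positivity
    have hLxx0 : Lxx = 0 := by linarith
    have hLyx0 : Lyx = 0 := by
      have h : 4 * Lyx ^ 2 / μy = 0 := by linarith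
      simpa [hμy.ne'] using h
    have hLyy0 : Lyy = 0 := by
      have h : 8 * Lyy ^ 2 / μy ^ 2 = 0 := le_antisymm (by linarith) (by positivity)
      simpa [hμy.ne'] using h
    subst hLxx0 hLyx0 hLyy0 hτ hσ hα
    refine ⟨by simp, ?_⟩
    convert Matrix.PosSemidef.zero (n := Fin 3) (R := ℝ) using 1
    ext i j
    fin_cases i <;> fin_cases j <;> simp
  · have hτx : τ * μx = (1 - θ) / θ := by
      rw [hτ]
      field_simp
    have hσy : σ * μy = (1 - θ) / θ := by
      rw [hσ]
      field_simp
    refine ⟨by rw [hτx, hσy, min_self], ?_⟩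
    have hαθ : α / θ = μy / 2 := by
      rw [hα]
      field_simp
    rw [hαθ]
    refine posSemidef_arrow hμy ?_ ?_
    · rw [hτ, one_div_div, le_sub_iff_add_le, le_div_iff₀ h1θ]
      linarith
    · have hB : 1 / σ - α = μy / (2 * (1 - θ)) * (θ * (1 + θ)) := by
        rw [hσ, hα, one_div_div]
        field_simp
        ring
      calc 4 * Lyy ^ 2 / μy
          = μy / (2 * (1 - θ)) * (8 * Lyy ^ 2 / μy ^ 2 * (1 - θ)) := by
            field_simp
            ring
        _ ≤ μy / (2 * (1 - θ)) * (θ * (1 + θ)) := by gcongr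
        _ = 1 / σ - α := hB.symm
end

section
/- Let μ_x, μ_y > 0 and L_xx, L_yx ≥ 0, let θ ∈ [θ̂₁, 1), and set τ = (1−θ)/(μ_x θ) and α = θ μ_y/2. Then the real symmetric 3×3 matrix G₁ = [[1/τ − L_xx, 0, −L_yx], [0, 0, 0], [−L_yx, 0, α/(2θ)]] is positive semidefinite. -/
open Matrix Set

/-- A symmetric matrix supported on the first and third coordinates is positive semidefinite when
its quadratic form is nonnegative. -/
theorem posSemidef_of_quadratic_nonneg {a b d : ℝ}
    (h : ∀ x z : ℝ, 0 ≤ a * x ^ 2 + 2 * b * x * z + d * z ^ 2) :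
    Matrix.PosSemidef (!![a, 0, b; 0, 0, 0; b, 0, d]) := by
  refine Matrix.PosSemidef.of_dotProduct_mulVec_nonneg ?_ fun v => ?_
  · ext i j
    fin_cases i <;> fin_cases j <;> simp
  · have hv := h (v 0) (v 2)
    simp only [dotProduct, mulVec, Fin.sum_univ_three, Pi.star_apply, star_trivial, of_apply,
      cons_val', cons_val_zero, cons_val_one, cons_val]
    linarith

/-- The defining property of `hatTheta1`, cleared of denominators. -/
theorem mul_one_sub_le_of_hatTheta1_le {μx μy Lxx Lyx θ : ℝ} (hμx : 0 < μx) (hμy : 0 < μy)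
    (hLxx : 0 ≤ Lxx) (h : hatTheta1 μx μy Lxx Lyx ≤ θ) :
    (Lxx + 4 * Lyx ^ 2 / μy) * (1 - θ) ≤ μx * θ := by
  have hpos : 0 < μx + Lxx + 4 * Lyx ^ 2 / μy := by positivity
  rw [hatTheta1, div_le_iff₀ hpos] at h
  linarith

/-- for θ ∈ [θ̂₁, 1), τ = (1−θ)/(μ_x θ) and α = θμ_y/2, the matrix
G₁ = [[1/τ − L_xx, 0, −L_yx], [0, 0, 0], [−L_yx, 0, α/(2θ)]] is positive semidefinite. -/
theorem sapd_G1_posSemidef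
    (μx μy Lxx Lyx : ℝ) (hμx : 0 < μx) (hμy : 0 < μy)
    (hLxx : 0 ≤ Lxx) (hLyx : 0 ≤ Lyx)
    (θ : ℝ) (hθ : θ ∈ Set.Ico (hatTheta1 μx μy Lxx Lyx) 1)
    (τ α : ℝ) (hτ : τ = (1 - θ) / (μx * θ)) (hα : α = θ * μy / 2) :
    Matrix.PosSemidef
      (!![1 / τ - Lxx, 0, -Lyx;
          0, 0, 0;
          -Lyx, 0, α / (2 * θ)]) := by
  obtain ⟨hθ₀, hθ₁⟩ := hθ
  have hS : Lxx + 4 * Lyx ^ 2 / μy ≤ 1 / τ := by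
    rw [hτ, one_div_div, le_div_iff₀ (sub_pos.2 hθ₁)]
    exact mul_one_sub_le_of_hatTheta1_le hμx hμy hLxx hθ₀
  have hnonneg : 0 ≤ hatTheta1 μx μy Lxx Lyx := by
    unfold hatTheta1
    positivity
  refine posSemidef_of_quadratic_nonneg fun x z => ?_
  rcases (hnonneg.trans hθ₀).eq_or_lt with rfl | hpos
  · have hS' : Lxx + 4 * Lyx ^ 2 / μy ≤ 0 := by simpa [hτ] using hS
    have hL : 4 * Lyx ^ 2 / μy = 0 := le_antisymm (by linarith) (by positivity)
    have hLyx' : Lyx = 0 := by simpa [hμy.ne'] using hL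
    have hLxx' : Lxx = 0 := by linarith
    simp [hτ, hLyx', hLxx']
  · have hd : α / (2 * θ) = μy / 4 := by
      rw [hα]
      field_simp
      norm_num
    have hsq : 4 * Lyx ^ 2 / μy * x ^ 2 + 2 * -Lyx * x * z + μy / 4 * z ^ 2
        = μy * (2 * Lyx * x / μy - z / 2) ^ 2 := by
      field_simp
      ring
    have hx : 4 * Lyx ^ 2 / μy * x ^ 2 ≤ (1 / τ - Lxx) * x ^ 2 :=
      mul_le_mul_of_nonneg_right (by linarith) (sq_nonneg x)
    have hnn : 0 ≤ μy * (2 * Lyx * x / μy - z / 2) ^ 2 := by positivity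
    rw [hd]
    linarith
end

section
/- Let μ_y > 0 and L_yy ≥ 0, let θ ∈ [θ̂₂, 1), and set σ = (1−θ)/(μ_y θ) and α = θ μ_y/2. Then the real symmetric 3×3 matrix G₂ = [[0, 0, 0], [0, 1/σ − α, −L_yy], [0, −L_yy, α/(2θ)]] is positive semidefinite. -/
open Matrix Set

/-- The quadratic form `a x² - 2 b x y + c y²` is nonnegative when `a, c ≥ 0` and `b² ≤ a c`. -/
lemma quadratic_form_nonneg_of_sq_le_mul {a b c : ℝ} (ha : 0 ≤ a) (hc : 0 ≤ c)
    (h : b ^ 2 ≤ a * c) (x y : ℝ) : 0 ≤ a * x ^ 2 - 2 * b * x * y + c * y ^ 2 := by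
  rcases ha.eq_or_lt with rfl | ha
  · obtain rfl : b = 0 := by nlinarith
    nlinarith [mul_nonneg hc (sq_nonneg y)]
  · refine (mul_nonneg_iff_of_pos_left ha).1 ?_
    nlinarith [sq_nonneg (a * x - b * y), mul_nonneg (sub_nonneg.2 h) (sq_nonneg y)]

/-- A symmetric `2 × 2` block bordered by zeros is positive semidefinite when its diagonal and
determinant are nonnegative. -/
lemma posSemidef_zero_bordered {a b c : ℝ} (ha : 0 ≤ a) (hc : 0 ≤ c) (h : b ^ 2 ≤ a * c) :
    Matrix.PosSemidef (!![0, 0, 0; 0, a, -b; 0, -b, c]) := by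
  refine Matrix.PosSemidef.of_dotProduct_mulVec_nonneg ?_ fun x => ?_
  · ext i j
    fin_cases i <;> fin_cases j <;> simp
  · have key := quadratic_form_nonneg_of_sq_le_mul ha hc h (x 1) (x 2)
    simp only [Matrix.mulVec, dotProduct, Fin.sum_univ_three, Pi.star_apply, star_trivial,
      Matrix.of_apply, Matrix.cons_val]
    linarith

/-- for θ ∈ [θ̂₂, 1) where θ̂₂ is the unique nonnegative root of
θ² + θ(1 + 8L_yy²/μ_y²) − 8L_yy²/μ_y² = 0, with σ = (1−θ)/(μ_y θ) and α = θμ_y/2,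
the matrix G₂ = [[0,0,0],[0, 1/σ − α, −L_yy],[0, −L_yy, α/(2θ)]] is positive
semidefinite. -/
theorem sapd_G2_posSemidef
    (μy Lyy : ℝ) (hμy : 0 < μy) (hLyy : 0 ≤ Lyy)
    (θ2 : ℝ) (hθ2nonneg : 0 ≤ θ2)
    (hθ2root : θ2 ^ 2 + θ2 * (1 + 8 * Lyy ^ 2 / μy ^ 2) - 8 * Lyy ^ 2 / μy ^ 2 = 0)
    (θ : ℝ) (hθ : θ ∈ Set.Ico θ2 1)
    (σ α : ℝ) (hσ : σ = (1 - θ) / (μy * θ)) (hα : α = θ * μy / 2) :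
    Matrix.PosSemidef
      (!![0, 0, 0;
          0, 1 / σ - α, -Lyy;
          0, -Lyy, α / (2 * θ)]) := by
  obtain ⟨hle, hlt⟩ := hθ
  have hθ0 : 0 ≤ θ := hθ2nonneg.trans hle
  have hpos : 0 < 1 - θ := sub_pos.2 hlt
  set k : ℝ := 8 * Lyy ^ 2 / μy ^ 2 with hk
  have hk0 : 0 ≤ k := by positivity
  have hL : Lyy ^ 2 = k * μy ^ 2 / 8 := by
    rw [hk]
    field_simp
  have hroot : k * (1 - θ) ≤ θ * (1 + θ) := by
    nlinarith [mul_nonneg hk0 (sub_nonneg.2 hle),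
      mul_nonneg (sub_nonneg.2 hle) (add_nonneg hθ0 hθ2nonneg)]
  subst hσ hα
  rcases hθ0.eq_or_lt with rfl | hθpos
  · refine posSemidef_zero_bordered (by simp) (by simp) ?_
    have hk_eq : k = 0 := by linarith
    simp [hL, hk_eq]
  · have ha : 1 / ((1 - θ) / (μy * θ)) - θ * μy / 2 = μy * (θ * (1 + θ)) / (2 * (1 - θ)) := by
      field_simp
      ring
    have hc : θ * μy / 2 / (2 * θ) = μy / 4 := by
      field_simp
      norm_num
    rw [ha, hc]
    refine posSemidef_zero_bordered (by positivity) (by positivity) ?_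
    rw [hL, div_mul_div_comm, div_le_div_iff₀ (by norm_num) (by positivity)]
    nlinarith [mul_le_mul_of_nonneg_left hroot (sq_nonneg μy)]
end

section
/- Let μ_x, μ_y > 0, let H₁ ∈ ℝ^{d_x×d_x} be symmetric positive definite, H₃ ∈ ℝ^{d_y×d_y} symmetric negative definite, and H₂ ∈ ℝ^{d_x×d_y} arbitrary. Form the symmetric matrix H = [[H₁, H₂],[H₂ᵀ, H₃]] ∈ ℝ^{d×d} (d = d_x + d_y) and the diagonal matrix C₀ = [[−(1/μ_x) I_{d_x}, 0],[0, (1/μ_y) I_{d_y}]]. Then the matrix C₀H is stable: every eigenvalue λ ∈ ℂ of C₀H satisfies Re(λ) < 0. -/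
open Matrix

section

open scoped ComplexOrder

theorem Matrix.PosDef.fromBlocks_zero {m n 𝕜 : Type*} [Fintype m] [Fintype n] [RCLike 𝕜]
    {A : Matrix m m 𝕜} {D : Matrix n n 𝕜} (hA : A.PosDef) (hD : D.PosDef) :
    (fromBlocks A 0 0 D).PosDef := by
  refine .of_dotProduct_mulVec_pos (hA.isHermitian.fromBlocks (by simp) hD.isHermitian)
    fun x hx ↦ ?_
  have hsum : star x ⬝ᵥ (fromBlocks A 0 0 D *ᵥ x) =
      star (x ∘ Sum.inl) ⬝ᵥ (A *ᵥ (x ∘ Sum.inl)) + star (x ∘ Sum.inr) ⬝ᵥ (D *ᵥ (x ∘ Sum.inr)) := by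
    simp [fromBlocks_mulVec, dotProduct, Fintype.sum_sum_type]
  rw [hsum]
  by_cases hl : x ∘ Sum.inl = 0
  · have hr : x ∘ Sum.inr ≠ 0 := fun hr ↦
      hx (funext (Sum.rec (congrFun hl) (congrFun hr)))
    simpa [hl] using hD.dotProduct_mulVec_pos hr
  · exact add_pos_of_pos_of_nonneg (hA.dotProduct_mulVec_pos hl)
      (hD.posSemidef.dotProduct_mulVec_nonneg _)

/-- **Lyapunov's criterion**: if `P` and `-(P * A + Aᴴ * P)` are positive definite, then every
eigenvalue of `A` has negative real part. -/
theorem Matrix.re_neg_of_mem_spectrum_of_posDef {n : Type*} [Fintype n] [DecidableEq n]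
    {A P : Matrix n n ℂ} (hP : P.PosDef) (hQ : (-(P * A + Aᴴ * P)).PosDef) {z : ℂ}
    (hz : z ∈ spectrum ℂ A) : z.re < 0 := by
  rw [← spectrum_toLin', ← Module.End.hasEigenvalue_iff_mem_spectrum] at hz
  obtain ⟨v, hv⟩ := hz.exists_hasEigenvector
  have hAv : A *ᵥ v = z • v := by simpa using hv.apply_eq_smul
  have hPv := hP.re_dotProduct_pos hv.2
  have hQv := hQ.re_dotProduct_pos hv.2
  have hkey : star v ⬝ᵥ (-(P * A + Aᴴ * P) *ᵥ v) =
      -((z + star z) * (star v ⬝ᵥ (P *ᵥ v))) := by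
    have hl : star v ᵥ* Aᴴ = star z • star v := by rw [← star_mulVec, hAv, star_smul]
    rw [neg_mulVec, dotProduct_neg, add_mulVec, dotProduct_add, ← mulVec_mulVec, ← mulVec_mulVec,
      dotProduct_mulVec (star v) Aᴴ, hl, hAv, mulVec_smul, dotProduct_smul, smul_dotProduct]
    simp only [smul_eq_mul]
    ring
  rw [hkey] at hQv
  simp at hQv hPv
  nlinarith

open scoped MatrixOrder Matrix.Norms.L2Operator in
theorem Matrix.PosDef.map_algebraMap {n 𝕜 : Type*} [Fintype n] [DecidableEq n] [RCLike 𝕜]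
    {M : Matrix n n ℝ} (hM : M.PosDef) : (M.map (algebraMap ℝ 𝕜)).PosDef := by
  obtain ⟨B, hB, rfl⟩ := CStarAlgebra.isStrictlyPositive_iff_eq_star_mul_self.mp
    hM.isStrictlyPositive
  have hstar : (star B).map (algebraMap ℝ 𝕜) = (B.map (algebraMap ℝ 𝕜))ᴴ := by
    ext i j; simp
  rw [Matrix.map_mul, hstar]
  exact .conjTranspose_mul_self _ (mulVec_injective_of_isUnit
    (hB.map (algebraMap ℝ 𝕜).mapMatrix))

/-- Lyapunov's criterion for the complex eigenvalues of a real matrix. -/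
theorem Matrix.re_neg_of_mem_spectrum_map_of_posDef {n : Type*} [Fintype n] [DecidableEq n]
    {A P : Matrix n n ℝ} (hP : P.PosDef) (hQ : (-(P * A + Aᵀ * P)).PosDef) {z : ℂ}
    (hz : z ∈ spectrum ℂ (A.map (algebraMap ℝ ℂ))) : z.re < 0 := by
  refine re_neg_of_mem_spectrum_of_posDef (hP.map_algebraMap (𝕜 := ℂ)) ?_ hz
  have hmap : (-(P * A + Aᵀ * P)).map (algebraMap ℝ ℂ) =
      -(P.map (algebraMap ℝ ℂ) * A.map (algebraMap ℝ ℂ) +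
        (A.map (algebraMap ℝ ℂ))ᴴ * P.map (algebraMap ℝ ℂ)) := by
    ext i j
    simp [Matrix.mul_apply]
  exact hmap ▸ hQ.map_algebraMap (𝕜 := ℂ)

end

/-- stability of C₀H. For μ_x, μ_y > 0, H₁ ≻ 0, H₃ ≺ 0 symmetric and H₂
arbitrary, every eigenvalue of C₀H, where H = [[H₁,H₂],[H₂ᵀ,H₃]] and
C₀ = diag(−(1/μ_x)I, (1/μ_y)I), has strictly negative real part. -/
theorem C0H_stable
    {dx dy : ℕ} (μx μy : ℝ) (hμx : 0 < μx) (hμy : 0 < μy)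
    (H1 : Matrix (Fin dx) (Fin dx) ℝ) (H2 : Matrix (Fin dx) (Fin dy) ℝ)
    (H3 : Matrix (Fin dy) (Fin dy) ℝ)
    (hH1 : H1.PosDef) (hH3 : (-H3).PosDef) :
    ∀ lam ∈ spectrum ℂ
      (((Matrix.fromBlocks (-(1 / μx) • (1 : Matrix (Fin dx) (Fin dx) ℝ)) 0 0
            ((1 / μy) • (1 : Matrix (Fin dy) (Fin dy) ℝ))) *
          (Matrix.fromBlocks H1 H2 H2ᵀ H3)).map (algebraMap ℝ ℂ)),
      lam.re < 0 := by
  have hP : (fromBlocks (μx • (1 : Matrix (Fin dx) (Fin dx) ℝ)) 0 0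
      (μy • (1 : Matrix (Fin dy) (Fin dy) ℝ))).PosDef :=
    (PosDef.one.smul hμx).fromBlocks_zero (PosDef.one.smul hμy)
  have hQ : (fromBlocks (H1 + H1) 0 0 (-H3 + -H3)).PosDef :=
    (hH1.add hH1).fromBlocks_zero (hH3.add hH3)
  have hH1t : H1ᵀ = H1 := by simpa using hH1.isHermitian.eq
  have hH3t : H3ᵀ = H3 := by simpa using hH3.isHermitian.eq
  refine fun lam ↦ re_neg_of_mem_spectrum_map_of_posDef hP ?_
  convert hQ using 1
  simp [fromBlocks_multiply, fromBlocks_transpose, fromBlocks_add, fromBlocks_neg, hH1t, hH3t,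
    hμx.ne', hμy.ne']
end
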